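/- Let q ≥ 3 and 1 ≤ d ≤ (n+1)/2. Any Boolean function f : (ℤ_q)^n → {−1,1} whose spectrum is contained in {0, d} (i.e., f̂(u) = 0 unless |u| = 0 or |u| = d) has at most (d/2) · q^{2d} / (2^d (q−1)^d) relevant variables. -/

import Mathlib

open Finset BigOperators
open scoped Classical

/-- The character `χ_u(x) = ω^{⟨u,x⟩}` on `(ℤ_q)^n`, with `ω = e^{2πi/q}`. -/
noncomputable def chi (q n : ℕ) (u x : Fin n → ZMod q) : ℂ :=
  Complex.exp (2 * Real.pi * Complex.I * (((∑ i, u i * x i).val : ℕ) : ℂ) / q)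

/-- Fourier coefficient `f̂(u) = q^{-n} Σ_x f(x) conj(χ_u(x))`. -/
noncomputable def fhat (q n : ℕ) [NeZero q] (f : (Fin n → ZMod q) → ℂ)
    (u : Fin n → ZMod q) : ℂ :=
  (1 / (q : ℂ) ^ n) * ∑ x, f x * (starRingEnd ℂ) (chi q n u x)

/-- Adjacency operator of the Hamming graph `H(n,q)`. -/
noncomputable def adjOp (q n : ℕ) [NeZero q] (f : (Fin n → ZMod q) → ℂ)
    (x : Fin n → ZMod q) : ℂ :=
  ∑ y ∈ univ.filter (fun y => hammingDist x y = 1), f y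

/-- Twice the number of edges `{x,y}` of `H(n,q)` with `f x ≠ f y`
(the number of ordered such pairs). -/
noncomputable def nuOrd (q n : ℕ) [NeZero q] {α : Type*} (f : (Fin n → ZMod q) → α) : ℕ :=
  (univ.filter (fun p : (Fin n → ZMod q) × (Fin n → ZMod q) =>
    hammingDist p.1 p.2 = 1 ∧ f p.1 ≠ f p.2)).card

/-- Coordinate `i` is relevant for `f`. -/
def Relevant {q n : ℕ} {α : Type*} (f : (Fin n → ZMod q) → α) (i : Fin n) : Prop :=
  ∃ x y : Fin n → ZMod q, (∀ j, j ≠ i → x j = y j) ∧ f x ≠ f y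

/-- The function `f_{i,a,b}` on `(ℤ_q)^n` obtained from `f` on `(ℤ_q)^{n+1}`. -/
noncomputable def restrictDiff {q n : ℕ} (f : (Fin (n + 1) → ZMod q) → ℂ)
    (i : Fin (n + 1)) (a b : ZMod q) : (Fin n → ZMod q) → ℂ :=
  fun y => f (i.insertNth a y) - f (i.insertNth b y)

/-- The size of the support of `g`. -/
noncomputable def suppCard (q n : ℕ) [NeZero q] (g : (Fin n → ZMod q) → ℂ) : ℕ :=
  (univ.filter (fun y => g y ≠ 0)).card

lemma chi_eq (q n : ℕ) [NeZero q] (u x : Fin n → ZMod q) :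
    chi q n u x = ZMod.stdAddChar (N := q) (∑ i, u i * x i) := by
  rw [chi, ZMod.stdAddChar_apply, ZMod.toCircle_apply]

lemma sum_e (q : ℕ) [NeZero q] (b : ZMod q) :
    ∑ c : ZMod q, ZMod.stdAddChar (N := q) (c * b) = if b = 0 then (q : ℂ) else 0 := by
  have h := AddChar.sum_mulShift b (ZMod.isPrimitive_stdAddChar q)
  rw [h]
  split_ifs <;> simp [ZMod.card]

lemma e_sum (q n : ℕ) [NeZero q] (g : Fin n → ZMod q) :
    ZMod.stdAddChar (N := q) (∑ i, g i) = ∏ i, ZMod.stdAddChar (N := q) (g i) := by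
  have : ∀ s : Finset (Fin n), ZMod.stdAddChar (N := q) (∑ i ∈ s, g i)
      = ∏ i ∈ s, ZMod.stdAddChar (N := q) (g i) := by
    intro s
    induction s using Finset.induction_on with
    | empty => simp
    | insert a s ha ih => rw [Finset.sum_insert ha, Finset.prod_insert ha,
        AddChar.map_add_eq_mul, ih]
  exact this _

lemma sum_chi (q n : ℕ) [NeZero q] (x y : Fin n → ZMod q) :
    ∑ u, (starRingEnd ℂ) (chi q n u x) * chi q n u y = if x = y then (q : ℂ) ^ n else 0 := by
  have h1 : ∀ u : Fin n → ZMod q, (starRingEnd ℂ) (chi q n u x) * chi q n u y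
      = ∏ i, ZMod.stdAddChar (N := q) (u i * (y i - x i)) := by
    intro u
    rw [chi_eq, chi_eq, ← AddChar.map_neg_eq_conj, ← AddChar.map_add_eq_mul]
    rw [← e_sum]
    congr 1
    rw [← Finset.sum_neg_distrib, ← Finset.sum_add_distrib]
    exact Finset.sum_congr rfl fun i _ => by ring
  simp_rw [h1]
  rw [← Fintype.prod_sum (fun i c => ZMod.stdAddChar (N := q) (c * (y i - x i)))]
  simp_rw [sum_e]
  split_ifs with h
  · subst h; simp
  · obtain ⟨i, hi⟩ := Function.ne_iff.mp h
    apply Finset.prod_eq_zero (Finset.mem_univ i)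
    rw [if_neg]
    exact sub_ne_zero.mpr (Ne.symm hi)

lemma parseval_c (q n : ℕ) [NeZero q] (f : (Fin n → ZMod q) → ℂ) :
    (q : ℂ) ^ n * ∑ u, fhat q n f u * (starRingEnd ℂ) (fhat q n f u)
      = ∑ x, f x * (starRingEnd ℂ) (f x) := by
  have hq : (q : ℂ) ^ n ≠ 0 := pow_ne_zero _ (Nat.cast_ne_zero.mpr (NeZero.ne q))
  have h1 : ∀ u, fhat q n f u * (starRingEnd ℂ) (fhat q n f u)
      = (1 / (q : ℂ) ^ n) * (1 / (q : ℂ) ^ n) * ∑ x, ∑ y, f x * (starRingEnd ℂ) (f y) *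
        ((starRingEnd ℂ) (chi q n u x) * chi q n u y) := by
    intro u
    simp only [fhat, map_mul, map_sum, map_div₀, map_pow, map_one, Complex.conj_natCast,
      Complex.conj_conj]
    rw [mul_mul_mul_comm, Finset.sum_mul_sum]
    congr 1
    refine Finset.sum_congr rfl fun x _ => Finset.sum_congr rfl fun y _ => by ring
  simp_rw [h1]
  rw [← Finset.mul_sum, Finset.sum_comm]
  have h2 : ∀ x, ∑ u, ∑ y, f x * (starRingEnd ℂ) (f y) *
        ((starRingEnd ℂ) (chi q n u x) * chi q n u y) = f x * (starRingEnd ℂ) (f x) * (q : ℂ) ^ n := by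
    intro x
    rw [Finset.sum_comm]
    simp_rw [← Finset.mul_sum, sum_chi]
    simp
  simp_rw [h2]
  rw [← Finset.sum_mul]
  field_simp

lemma parseval (q n : ℕ) [NeZero q] (f : (Fin n → ZMod q) → ℂ) :
    (q : ℝ) ^ n * ∑ u, ‖fhat q n f u‖ ^ 2 = ∑ x, ‖f x‖ ^ 2 := by
  have h := parseval_c q n f
  simp_rw [Complex.mul_conj'] at h
  exact_mod_cast h

lemma exists_fhat (q n : ℕ) [NeZero q] (f : (Fin n → ZMod q) → ℂ) (hf : f ≠ 0) :
    ∃ u, fhat q n f u ≠ 0 := by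
  by_contra! h
  apply hf
  have h1 := parseval q n f
  simp only [h, norm_zero] at h1
  simp at h1
  have h2 := (Finset.sum_eq_zero_iff_of_nonneg (fun x _ => by positivity)).mp h1.symm
  funext x
  simpa using h2 x (Finset.mem_univ x)

lemma fhat_sub (q n : ℕ) [NeZero q] (f g : (Fin n → ZMod q) → ℂ) (u : Fin n → ZMod q) :
    fhat q n (fun x => f x - g x) u = fhat q n f u - fhat q n g u := by
  simp only [fhat, sub_mul, Finset.sum_sub_distrib, mul_sub]

lemma fhat_shift (q n : ℕ) [NeZero q] (f : (Fin n → ZMod q) → ℂ) (i : Fin n) (c : ZMod q)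
    (u : Fin n → ZMod q) :
    fhat q n (fun x => f (x + Pi.single i c)) u
      = ZMod.stdAddChar (N := q) (u i * c) * fhat q n f u := by
  simp only [fhat]
  rw [mul_left_comm]
  congr 1
  rw [Finset.mul_sum, ← Equiv.sum_comp (Equiv.addRight (Pi.single i c))
    (fun x => ZMod.stdAddChar (N := q) (u i * c) * (f x * (starRingEnd ℂ) (chi q n u x)))]
  refine Finset.sum_congr rfl fun x _ => ?_
  rw [mul_left_comm]
  congr 1
  rw [chi_eq, chi_eq, ← AddChar.map_neg_eq_conj, ← AddChar.map_neg_eq_conj,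
    ← AddChar.map_add_eq_mul]
  congr 1
  simp only [Equiv.coe_addRight, Pi.add_apply, mul_add, Finset.sum_add_distrib]
  have : ∑ j, u j * (Pi.single i c : Fin n → ZMod q) j = u i * c := by
    rw [Finset.sum_eq_single i]
    · simp
    · intro j _ hj; simp [Pi.single_eq_of_ne hj]
    · simp
  rw [this]; ring

lemma norm_e (q : ℕ) [NeZero q] (b : ZMod q) :
    ∑ c : ZMod q, ‖ZMod.stdAddChar (N := q) (b * c) - 1‖ ^ 2
      = if b = 0 then (0 : ℝ) else 2 * q := by
  split_ifs with h
  · simp [h]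
  · have h1 : ∀ c : ZMod q, ((‖ZMod.stdAddChar (N := q) (b * c) - 1‖ ^ 2 : ℝ) : ℂ)
        = 2 - ZMod.stdAddChar (N := q) (c * b) - ZMod.stdAddChar (N := q) (c * (-b)) := by
      intro c
      push_cast
      rw [← Complex.mul_conj']
      have : c * (-b) = - (b * c) := by ring
      rw [this, mul_comm c b, map_sub, map_one, ← AddChar.map_neg_eq_conj]
      have h2 : ZMod.stdAddChar (N := q) (b * c) * ZMod.stdAddChar (N := q) (-(b * c)) = 1 := by
        rw [← AddChar.map_add_eq_mul]; simp
      linear_combination h2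
    have h3 : ((∑ c : ZMod q, ‖ZMod.stdAddChar (N := q) (b * c) - 1‖ ^ 2 : ℝ) : ℂ)
        = ((2 * q : ℝ) : ℂ) := by
      push_cast
      push_cast at h1
      simp_rw [h1]
      rw [Finset.sum_sub_distrib, Finset.sum_sub_distrib, sum_e, sum_e]
      simp [h, ZMod.card, mul_comm]
    exact_mod_cast h3

lemma energy (q n : ℕ) [NeZero q] (f : (Fin n → ZMod q) → ℂ) (i : Fin n) :
    ∑ c : ZMod q, ∑ x, ‖f (x + Pi.single i c) - f x‖ ^ 2
      = (q : ℝ) ^ n * ∑ u, (if u i = 0 then (0 : ℝ) else 2 * q) * ‖fhat q n f u‖ ^ 2 := by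
  have h1 : ∀ c : ZMod q, ∑ x, ‖f (x + Pi.single i c) - f x‖ ^ 2
      = (q : ℝ) ^ n * ∑ u, ‖ZMod.stdAddChar (N := q) (u i * c) - 1‖ ^ 2 * ‖fhat q n f u‖ ^ 2 := by
    intro c
    rw [← parseval q n (fun x : Fin n → ZMod q => f (x + (Pi.single i c : Fin n → ZMod q)) - f x)]
    congr 1
    refine Finset.sum_congr rfl fun u _ => ?_
    rw [fhat_sub q n (fun x : Fin n → ZMod q => f (x + (Pi.single i c : Fin n → ZMod q))) f, fhat_shift, ← sub_one_mul, norm_mul,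
      mul_pow]
  simp_rw [h1]
  rw [← Finset.mul_sum, Finset.sum_comm]
  simp_rw [← Finset.sum_mul, norm_e]

lemma sum_insertNth {q n : ℕ} [NeZero q] {M : Type*} [AddCommMonoid M] (i : Fin (n + 1))
    (g : (Fin (n + 1) → ZMod q) → M) :
    ∑ x, g x = ∑ a : ZMod q, ∑ y : Fin n → ZMod q, g (i.insertNth a y) := by
  rw [← Fintype.sum_prod_type' (fun a y => g (i.insertNth a y))]
  exact (Equiv.sum_comp (Fin.insertNthEquiv (fun _ => ZMod q) i) g).symm

lemma chi_insertNth (q n : ℕ) [NeZero q] (i : Fin (n + 1)) (c a : ZMod q) (v y : Fin n → ZMod q) :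
    chi q (n + 1) (i.insertNth c v) (i.insertNth a y)
      = ZMod.stdAddChar (N := q) (c * a) * chi q n v y := by
  rw [chi_eq, chi_eq, ← AddChar.map_add_eq_mul, Fin.sum_univ_succAbove _ i]
  simp

lemma fhat_slice (q n : ℕ) [NeZero q] (f : (Fin (n + 1) → ZMod q) → ℂ) (i : Fin (n + 1))
    (a : ZMod q) (v : Fin n → ZMod q) :
    fhat q n (fun y => f (i.insertNth a y)) v
      = ∑ c : ZMod q, fhat q (n + 1) f (i.insertNth c v) * ZMod.stdAddChar (N := q) (c * a) := by
  have hq : (q : ℂ) ≠ 0 := (Nat.cast_ne_zero.mpr (NeZero.ne q))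
  simp only [fhat]
  simp_rw [sum_insertNth i, chi_insertNth]
  have h1 : ∀ c : ZMod q, (1 / (q : ℂ) ^ (n + 1) * ∑ b : ZMod q, ∑ y : Fin n → ZMod q,
      f (i.insertNth b y) * (starRingEnd ℂ) (ZMod.stdAddChar (N := q) (c * b) * chi q n v y))
        * ZMod.stdAddChar (N := q) (c * a)
      = 1 / (q : ℂ) ^ (n + 1) * ∑ b : ZMod q, (∑ y : Fin n → ZMod q,
      f (i.insertNth b y) * (starRingEnd ℂ) (chi q n v y)) *
        ZMod.stdAddChar (N := q) (c * (a - b)) := by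
    intro c
    rw [mul_assoc, Finset.sum_mul]
    congr 1
    refine Finset.sum_congr rfl fun b _ => ?_
    rw [Finset.sum_mul, Finset.sum_mul]
    refine Finset.sum_congr rfl fun y _ => ?_
    rw [map_mul, ← AddChar.map_neg_eq_conj, mul_sub, sub_eq_add_neg, AddChar.map_add_eq_mul]
    ring
  simp_rw [h1]
  rw [← Finset.mul_sum, Finset.sum_comm]
  simp_rw [← Finset.mul_sum, sum_e]
  rw [Finset.sum_eq_single a]
  · simp only [sub_self, if_true]
    field_simp
    ring
  · intro b _ hb
    rw [if_neg (sub_ne_zero.mpr (Ne.symm hb)), mul_zero]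
  · simp

lemma hammingNorm_insertNth {q n : ℕ} [NeZero q] (i : Fin (n + 1)) (c : ZMod q)
    (v : Fin n → ZMod q) :
    hammingNorm (i.insertNth c v : Fin (n + 1) → ZMod q) = (if c = 0 then 0 else 1) + hammingNorm v := by
  simp only [hammingNorm, Finset.card_filter]
  rw [Fin.sum_univ_succAbove _ i]
  simp

/-- All nonzero Fourier coefficients of `f` have weight in `[i, J)`. -/
def Sp (q n : ℕ) [NeZero q] (f : (Fin n → ZMod q) → ℂ) (i J : ℕ) : Prop :=
  ∀ u : Fin n → ZMod q, fhat q n f u ≠ 0 → i ≤ hammingNorm u ∧ hammingNorm u < J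

/-- The cslice of `f` where coordinate `r` equals `a`. -/
def cslice {q n : ℕ} (f : (Fin (n + 1) → ZMod q) → ℂ) (r : Fin (n + 1)) (a : ZMod q) :
    (Fin n → ZMod q) → ℂ := fun y => f (r.insertNth a y)

lemma Sp_slice {q n : ℕ} [NeZero q] {f : (Fin (n + 1) → ZMod q) → ℂ} {i J : ℕ}
    (h : Sp q (n + 1) f i J) (r : Fin (n + 1)) (a : ZMod q) :
    Sp q n (cslice f r a) (i - 1) J := by
  intro v hv
  unfold cslice at hv
  rw [fhat_slice] at hv
  obtain ⟨c, _, hc⟩ := Finset.exists_ne_zero_of_sum_ne_zero hv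
  have h1 := h _ (left_ne_zero_of_mul hc)
  rw [hammingNorm_insertNth] at h1
  split_ifs at h1 <;> omega

lemma Sp_diff {q n : ℕ} [NeZero q] {f : (Fin (n + 1) → ZMod q) → ℂ} {i J : ℕ}
    (h : Sp q (n + 1) f i J) (r : Fin (n + 1)) (a b : ZMod q) :
    Sp q n (fun y => cslice f r a y - cslice f r b y) (i - 1) (J - 1) := by
  intro v hv
  rw [fhat_sub q n (cslice f r a) (cslice f r b)] at hv
  unfold cslice at hv
  rw [fhat_slice, fhat_slice, ← Finset.sum_sub_distrib] at hv
  obtain ⟨c, _, hc⟩ := Finset.exists_ne_zero_of_sum_ne_zero hv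
  rw [← mul_sub] at hc
  have h1 := h _ (left_ne_zero_of_mul hc)
  rw [hammingNorm_insertNth] at h1
  split_ifs at h1 with h0
  · subst h0; simp at hc
  · omega

lemma Sp_single {q n : ℕ} [NeZero q] {f : (Fin (n + 1) → ZMod q) → ℂ} {i J : ℕ}
    (h : Sp q (n + 1) f i J) (r : Fin (n + 1)) (b : ZMod q)
    (hb : ∀ a, a ≠ b → cslice f r a = 0) :
    Sp q n (cslice f r b) i J := by
  intro v hv
  have hs : fhat q n (cslice f r b) v = ∑ a, fhat q n (cslice f r a) v := by
    symm
    apply Finset.sum_eq_single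
    · intro a _ ha
      rw [hb a ha]; simp [fhat]
    · simp
  rw [hs] at hv
  unfold cslice at hv
  simp_rw [fhat_slice] at hv
  rw [Finset.sum_comm] at hv
  obtain ⟨c, _, hc⟩ := Finset.exists_ne_zero_of_sum_ne_zero hv
  simp_rw [← Finset.mul_sum, mul_comm c] at hc
  rw [sum_e] at hc
  split_ifs at hc with h0
  · have h1 := h _ (left_ne_zero_of_mul hc)
    rw [hammingNorm_insertNth] at h1
    simpa [h0] using h1
  · simp at hc

lemma suppCard_eq {q n : ℕ} [NeZero q] (f : (Fin (n + 1) → ZMod q) → ℂ) (r : Fin (n + 1)) :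
    suppCard q (n + 1) f = ∑ a, suppCard q n (cslice f r a) := by
  have h : ∀ (m : ℕ) (g : (Fin m → ZMod q) → ℂ),
      suppCard q m g = ∑ x, if g x ≠ 0 then 1 else 0 := by
    intro m g
    rw [suppCard, Finset.card_filter]
  simp_rw [h]
  exact sum_insertNth r (fun x => if f x ≠ 0 then 1 else 0)

lemma suppCard_sub_le {q n : ℕ} [NeZero q] (f g : (Fin n → ZMod q) → ℂ) :
    suppCard q n (fun y => f y - g y) ≤ suppCard q n f + suppCard q n g := by
  simp only [suppCard]
  refine le_trans (Finset.card_le_card ?_) (Finset.card_union_le _ _)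
  intro y
  simp only [Finset.mem_filter, Finset.mem_univ, true_and, Finset.mem_union]
  contrapose!
  rintro ⟨h1, h2⟩
  simp [h1, h2]

lemma suppCard_pos {q n : ℕ} [NeZero q] {f : (Fin n → ZMod q) → ℂ} (hf : f ≠ 0) :
    1 ≤ suppCard q n f := by
  obtain ⟨x, hx⟩ := Function.ne_iff.mp hf
  exact Finset.card_pos.mpr ⟨x, by simpa using hx⟩

lemma exists_slice_ne {q n : ℕ} [NeZero q] {f : (Fin (n + 1) → ZMod q) → ℂ} {i J : ℕ}
    (h : Sp q (n + 1) f i J) (hi : 1 ≤ i) (hf : f ≠ 0) :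
    ∃ r a b, cslice f r a ≠ cslice f r b := by
  obtain ⟨u, hu⟩ := exists_fhat q (n + 1) f hf
  have hu1 : u ≠ 0 := by
    rintro rfl
    have := (h 0 hu).1
    simp at this
    omega
  obtain ⟨r, hr⟩ := Function.ne_iff.mp hu1
  refine ⟨r, ?_⟩
  by_contra! hall
  have h1 := fhat_shift q (n + 1) f r 1 u
  have h2 : (fun x : Fin (n + 1) → ZMod q => f (x + (Pi.single r 1 : Fin (n + 1) → ZMod q))) = f := by
    funext x
    have h3 := congrFun (hall (x r + 1) (x r)) (r.removeNth x)
    simp only [cslice] at h3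
    rw [Fin.insertNth_self_removeNth] at h3
    rw [← h3]
    congr 1
    funext j
    refine Fin.succAboveCases r ?_ ?_ j
    · simp
    · intro k
      simp [Fin.removeNth, Fin.succAbove_ne]
  rw [h2, mul_one] at h1
  have h4 : ZMod.stdAddChar (N := q) (u r) = ZMod.stdAddChar (N := q) 0 := by
    rw [AddChar.map_zero_eq_one]
    exact mul_right_cancel₀ hu (by rw [one_mul]; exact h1.symm)
  exact hr (ZMod.injective_stdAddChar h4)

lemma comb {q : ℕ} [NeZero q] (hq : 3 ≤ q) {X : Type*} (F : ZMod q → X) (z : X)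
    (W : ZMod q → ℕ) (hW : ∀ a b, F a = F b → W a = W b) (B : ℕ)
    (hne : ∃ a b, F a ≠ F b)
    (hA : ∀ a b, F a ≠ F b → q * B ≤ W a + W b)
    (hB : ∀ a, F a ≠ z → B ≤ W a)
    (hC : ∀ b, (∀ a, a ≠ b → F a = z) → 2 * (q - 1) * B ≤ W b) :
    2 * (q - 1) * B ≤ ∑ a, W a := by
  obtain ⟨p, rfl⟩ : ∃ p, q = p + 3 := ⟨q - 3, by omega⟩
  have four : ∀ a b c e : ZMod (p + 3), a ≠ b → a ≠ c → a ≠ e → b ≠ c → b ≠ e → c ≠ e →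
      F a ≠ F b → F c ≠ F e → 2 * (p + 3 - 1) * B ≤ ∑ a, W a := by
    intro a b c e h1 h2 h3 h4 h5 h6 h7 h8
    have h9 : ∑ x ∈ ({a, b, c, e} : Finset (ZMod (p + 3))), W x ≤ ∑ a, W a :=
      Finset.sum_le_sum_of_subset (Finset.subset_univ _)
    rw [Finset.sum_insert (by simp [h1, h2, h3]), Finset.sum_insert (by simp [h4, h5]),
      Finset.sum_insert (by simp [h6]), Finset.sum_singleton] at h9
    have h10 := hA _ _ h7
    have h11 := hA _ _ h8
    have : p + 3 - 1 = p + 2 := rfl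
    rw [this]
    nlinarith
  by_cases hone : ∃ b h, ∀ a, a ≠ b → F a = h
  · obtain ⟨b, h, hb⟩ := hone
    have hlow : W b ≤ ∑ a, W a := Finset.single_le_sum (fun _ _ => Nat.zero_le _) (Finset.mem_univ b)
    by_cases hz : h = z
    · subst hz
      exact (hC b hb).trans hlow
    · obtain ⟨c, hc⟩ : ∃ c : ZMod (p + 3), c ≠ b := by
        have : Fact (1 < p + 3) := ⟨by omega⟩
        exact exists_ne b
      have hFb : F b ≠ F c := by
        intro hbc
        obtain ⟨a1, b1, h1⟩ := hne
        have : ∀ a, F a = h := by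
          intro a
          by_cases ha : a = b
          · rw [ha, hbc, hb c hc]
          · exact hb a ha
        exact h1 (by rw [this, this])
      have hsum : ∑ a, W a = W b + (p + 2) * W c := by
        rw [← Finset.add_sum_erase _ _ (Finset.mem_univ b)]
        congr 1
        rw [Finset.sum_congr rfl (g := fun _ => W c)]
        · rw [Finset.sum_const, Finset.card_erase_of_mem (Finset.mem_univ _), Finset.card_univ,
            ZMod.card, smul_eq_mul]
          rfl
        · intro a ha
          apply hW
          rw [hb a (Finset.ne_of_mem_erase ha), hb c hc]
      have h1 := hA _ _ hFb
      have h2 := hB c (by rw [hb c hc]; exact hz)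
      have : p + 3 - 1 = p + 2 := rfl
      rw [this, hsum]
      nlinarith
  · push Not at hone
    obtain ⟨a, b, hab⟩ := hne
    obtain ⟨c, hca, hcb⟩ := hone a (F b)
    obtain ⟨e, heb, hea⟩ := hone b (F a)
    have nab : a ≠ b := fun h => hab (by rw [h])
    have ncb : c ≠ b := fun h => hcb (by rw [h])
    have nea : e ≠ a := fun h => hea (by rw [h])
    by_cases hce : c = e
    · subst hce
      by_cases hp : p = 0
      · subst hp
        have h9 : ∑ x ∈ ({a, b, c} : Finset (ZMod (0 + 3))), W x ≤ ∑ a, W a :=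
          Finset.sum_le_sum_of_subset (Finset.subset_univ _)
        rw [Finset.sum_insert (by simp [nab, hca.symm]), Finset.sum_insert (by simp [ncb.symm]),
          Finset.sum_singleton] at h9
        have h10 := hA _ _ hab
        have h11 := hA _ _ hcb
        have h12 := hA _ _ hea
        have : 0 + 3 - 1 = 2 := rfl
        rw [this]
        omega
      · obtain ⟨x, _, hx⟩ := Finset.exists_mem_notMem_of_card_lt_card
          (s := ({a, b, c} : Finset (ZMod (p + 3)))) (t := Finset.univ) (by
            rw [Finset.card_univ, ZMod.card]
            exact lt_of_le_of_lt Finset.card_le_three (by omega))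
        simp only [Finset.mem_insert, Finset.mem_singleton, not_or] at hx
        obtain ⟨xa, xb, xc⟩ := hx
        by_cases hxa : F x = F a
        · exact four x b a c xb xa xc nab.symm ncb.symm hca.symm (by rw [hxa]; exact hab) hea.symm
        · exact four x a b c xa xb xc nab hca.symm ncb.symm hxa hcb.symm
    · exact four b c a e ncb.symm nab.symm heb.symm hca hce nea.symm hcb.symm hea.symm

theorem supp_bound (q : ℕ) [NeZero q] (hq : 3 ≤ q) (n : ℕ) :
    ∀ (i J : ℕ) (f : (Fin n → ZMod q) → ℂ), Sp q n f i J → f ≠ 0 → i + J ≤ n + 1 →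
      2 ^ i * (q - 1) ^ i * q ^ (n + 1 - i - J) ≤ suppCard q n f := by
  induction n with
  | zero =>
    intro i J f hS hf hij
    obtain ⟨u, hu⟩ := exists_fhat q 0 f hf
    have h1 := hS u hu
    obtain ⟨rfl, rfl⟩ : i = 0 ∧ J = 1 := by omega
    simpa using suppCard_pos hf
  | succ n ih =>
    intro i J f hS hf hij
    have hJ : 1 ≤ J := by
      obtain ⟨u, hu⟩ := exists_fhat q _ f hf
      have h1 := hS u hu
      omega
    have hsl : ∀ r, ∃ b, cslice f r b ≠ 0 := by
      intro r
      obtain ⟨x, hx⟩ := Function.ne_iff.mp hf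
      refine ⟨x r, Function.ne_iff.mpr ⟨r.removeNth x, ?_⟩⟩
      simpa [cslice] using hx
    rcases Nat.eq_zero_or_pos i with rfl | hi
    · by_cases hJn : J = n + 2
      · subst hJn
        simpa using suppCard_pos hf
      · rw [suppCard_eq f 0]
        by_cases hz : ∃ a, cslice f 0 a = 0
        · obtain ⟨a, ha⟩ := hz
          obtain ⟨b, hb⟩ := hsl 0
          have h1 := Sp_diff hS 0 b a
          have h2 : (fun y => cslice f 0 b y - cslice f 0 a y) = cslice f 0 b := by
            funext y; simp [ha]
          rw [h2] at h1
          have h3 := ih _ _ _ h1 hb (by omega)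
          have h4 : n + 1 - (0 - 1) - (J - 1) = n + 1 + 1 - 0 - J := by omega
          rw [h4] at h3
          exact le_trans h3 (Finset.single_le_sum (f := fun a => suppCard q n (cslice f 0 a))
            (fun _ _ => Nat.zero_le _) (Finset.mem_univ b))
        · push Not at hz
          have h1 : ∀ a ∈ (Finset.univ : Finset (ZMod q)), q ^ (n + 1 - J) ≤ suppCard q n (cslice f 0 a) := by
            intro a _
            have := ih _ _ _ (Sp_slice hS 0 a) (hz a) (by omega)
            simpa using this
          have h2 := Finset.card_nsmul_le_sum _ _ _ h1
          rw [Finset.card_univ, ZMod.card, smul_eq_mul, ← pow_succ'] at h2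
          have h4 : n + 1 - J + 1 = n + 1 + 1 - 0 - J := by omega
          rw [h4] at h2
          simpa using h2
    · obtain ⟨k, rfl⟩ : ∃ k, i = k + 1 := ⟨i - 1, by omega⟩
      obtain ⟨r, hr⟩ := exists_slice_ne hS hi hf
      rw [suppCard_eq f r]
      have key := comb hq (cslice f r) 0 (fun a => suppCard q n (cslice f r a))
        (fun a b h => by simp only [h]) (2 ^ k * (q - 1) ^ k * q ^ (n + 1 - k - J)) hr ?_ ?_ ?_
      · have h4 : n + 1 + 1 - (k + 1) - J = n + 1 - k - J := by omega
        rw [h4]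
        refine le_trans (le_of_eq ?_) key
        ring
      · intro a b hab
        have h0 : (fun y => cslice f r a y - cslice f r b y) ≠ 0 := by
          intro h
          apply hab
          funext y
          exact sub_eq_zero.mp (congrFun h y)
        have h1 := ih _ _ _ (Sp_diff hS r a b) h0 (by omega)
        refine le_trans (le_trans (le_of_eq ?_) h1) (suppCard_sub_le _ _)
        have h4 : n + 1 - (k + 1 - 1) - (J - 1) = n + 1 - k - J + 1 := by omega
        rw [h4, Nat.add_sub_cancel]
        ring
      · intro a ha
        exact ih _ _ _ (Sp_slice hS r a) ha (by omega)
      · intro b hb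
        have hb0 : cslice f r b ≠ 0 := by
          obtain ⟨c, hc⟩ := hsl r
          by_cases hcb : c = b
          · rwa [← hcb]
          · exact absurd (hb c hcb) hc
        obtain ⟨a, hab⟩ : ∃ a : ZMod q, a ≠ b := by
          have : Fact (1 < q) := ⟨by omega⟩
          exact exists_ne b
        have h1 := Sp_diff hS r b a
        have h2 : (fun y => cslice f r b y - cslice f r a y) = cslice f r b := by
          funext y; simp [hb a hab]
        rw [h2] at h1
        have h3 := Sp_single hS r b hb
        have h5 : Sp q n (cslice f r b) (k + 1) (J - 1) := fun u hu => ⟨(h3 u hu).1, (h1 u hu).2⟩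
        have h6 := ih _ _ _ h5 hb0 (by omega)
        refine le_trans (le_of_eq ?_) h6
        have h4 : n + 1 - (k + 1) - (J - 1) = n + 1 - k - J := by omega
        rw [h4]
        ring

lemma pairs_bound {q : ℕ} [NeZero q] {X : Type*} (F : ZMod q → X)
    (N : ZMod q → ZMod q → ℕ) (M : ℕ) (hne : ∃ a b, F a ≠ F b)
    (hN : ∀ a b, F a ≠ F b → M ≤ N a b) :
    2 * (q - 1) * M ≤ ∑ a, ∑ b, N a b := by
  obtain ⟨a0, b0, h0⟩ := hne
  have n0 : a0 ≠ b0 := fun h => h0 (by rw [h])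
  have hq2 : 2 ≤ q := by
    have := Finset.card_le_card (Finset.subset_univ ({a0, b0} : Finset (ZMod q)))
    rwa [Finset.card_pair n0, Finset.card_univ, ZMod.card] at this
  have hsplit : ∑ a, ∑ b, N a b = ∑ a ∈ ({a0, b0} : Finset (ZMod q)), ∑ b, N a b
      + ∑ a ∈ ({a0, b0} : Finset (ZMod q))ᶜ, ∑ b, N a b := (Finset.sum_add_sum_compl _ _).symm
  rw [hsplit, Finset.sum_pair n0, ← Finset.sum_add_distrib]
  have h1 : q * M ≤ ∑ b, (N a0 b + N b0 b) := by
    have := Finset.card_nsmul_le_sum (Finset.univ : Finset (ZMod q)) (fun b => N a0 b + N b0 b) M ?_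
    · rwa [Finset.card_univ, ZMod.card, smul_eq_mul] at this
    · intro c _
      by_cases hc : F a0 = F c
      · exact le_trans (hN b0 c (by rw [← hc]; exact h0.symm)) (Nat.le_add_left _ _)
      · exact le_trans (hN a0 c hc) (Nat.le_add_right _ _)
  have h2 : (q - 2) * M ≤ ∑ a ∈ ({a0, b0} : Finset (ZMod q))ᶜ, ∑ b, N a b := by
    have := Finset.card_nsmul_le_sum ({a0, b0} : Finset (ZMod q))ᶜ (fun a => ∑ b, N a b) M ?_
    · rwa [Finset.card_compl, Finset.card_pair n0, ZMod.card, smul_eq_mul] at this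
    · intro c _
      have hs : ∀ b, N c b ≤ ∑ b, N c b := fun b =>
        Finset.single_le_sum (f := fun b => N c b) (fun _ _ => Nat.zero_le _) (Finset.mem_univ b)
      by_cases hc : F c = F a0
      · exact le_trans (hN c b0 (by rw [hc]; exact h0)) (hs _)
      · exact le_trans (hN c a0 hc) (hs _)
  obtain ⟨p, rfl⟩ : ∃ p, q = p + 2 := ⟨q - 2, by omega⟩
  simp only [Nat.add_sub_cancel] at h2
  have : p + 2 - 1 = p + 1 := rfl
  rw [this]
  nlinarith

lemma insertNth_add_single {q n : ℕ} (r : Fin (n + 1)) (a c : ZMod q) (y : Fin n → ZMod q) :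
    (r.insertNth a y : Fin (n + 1) → ZMod q) + (Pi.single r c : Fin (n + 1) → ZMod q)
      = r.insertNth (a + c) y := by
  funext j
  refine Fin.succAboveCases r ?_ ?_ j
  · simp
  · intro k
    simp [Fin.succAbove_ne]

lemma energy_slices {q n : ℕ} [NeZero q] (f : (Fin (n + 1) → ZMod q) → ℂ) (r : Fin (n + 1)) :
    ∑ c : ZMod q, ∑ x, ‖f (x + Pi.single r c) - f x‖ ^ 2
      = ∑ a, ∑ b, ∑ y, ‖cslice f r b y - cslice f r a y‖ ^ 2 := by
  rw [Finset.sum_comm, sum_insertNth r]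
  refine Finset.sum_congr rfl fun a _ => ?_
  rw [Finset.sum_comm]
  rw [← Equiv.sum_comp (Equiv.addLeft a)
    (fun b => ∑ y, ‖cslice f r b y - cslice f r a y‖ ^ 2)]
  refine Finset.sum_congr rfl fun c _ => Finset.sum_congr rfl fun y _ => ?_
  rw [insertNth_add_single]
  rfl

lemma bool_energy {q n : ℕ} [NeZero q] (f : (Fin (n + 1) → ZMod q) → ℂ)
    (hbool : ∀ x, f x = 1 ∨ f x = -1) (r : Fin (n + 1)) (a b : ZMod q) :
    ∑ y, ‖cslice f r b y - cslice f r a y‖ ^ 2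
      = 4 * (suppCard q n (fun y => cslice f r b y - cslice f r a y) : ℝ) := by
  simp only [suppCard, Finset.card_filter]
  push_cast
  rw [Finset.mul_sum]
  refine Finset.sum_congr rfl fun y _ => ?_
  unfold cslice
  rcases hbool (r.insertNth a y) with h1 | h1 <;> rcases hbool (r.insertNth b y) with h2 | h2 <;>
    rw [h1, h2] <;> norm_num

lemma relevant_slices {q n : ℕ} (f : (Fin (n + 1) → ZMod q) → ℂ) (r : Fin (n + 1))
    (h : Relevant f r) : ∃ a b, cslice f r a ≠ cslice f r b := by
  obtain ⟨x, y, hxy, hf⟩ := h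
  refine ⟨x r, y r, fun h => hf ?_⟩
  have h1 : r.removeNth x = r.removeNth y := by
    funext j
    exact hxy _ (Fin.succAbove_ne r j)
  have h2 := congrFun h (r.removeNth x)
  unfold cslice at h2
  rw [Fin.insertNth_self_removeNth, h1, Fin.insertNth_self_removeNth] at h2
  exact h2

lemma lower (q n d : ℕ) [NeZero q] (hq : 3 ≤ q) (hdn : 2 * (d + 1) ≤ n + 1 + 1)
    (f : (Fin (n + 1) → ZMod q) → ℂ) (hbool : ∀ x, f x = 1 ∨ f x = -1)
    (hcoef : ∀ u : Fin (n + 1) → ZMod q, fhat q (n + 1) f u ≠ 0 →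
      hammingNorm u = 0 ∨ hammingNorm u = d + 1) (r : Fin (n + 1)) (hr : Relevant f r) :
    4 * ((2 * (q - 1) * (2 ^ d * (q - 1) ^ d * q ^ (n - 2 * d)) : ℕ) : ℝ)
      ≤ ∑ c : ZMod q, ∑ x, ‖f (x + Pi.single r c) - f x‖ ^ 2 := by
  rw [energy_slices]
  simp_rw [bool_energy f hbool, ← Finset.mul_sum]
  gcongr
  exact_mod_cast pairs_bound (cslice f r)
    (fun a b => suppCard q n (fun y => cslice f r b y - cslice f r a y)) _
    (relevant_slices f r hr) (by
      intro a b hab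
      have h0 : (fun y => cslice f r b y - cslice f r a y) ≠ 0 := by
        intro h
        apply hab
        funext y
        exact (sub_eq_zero.mp (congrFun h y)).symm
      have hS : Sp q n (fun y => cslice f r b y - cslice f r a y) d (d + 1) := by
        intro v hv
        rw [fhat_sub q n (cslice f r b) (cslice f r a)] at hv
        unfold cslice at hv
        rw [fhat_slice, fhat_slice, ← Finset.sum_sub_distrib] at hv
        obtain ⟨c, _, hc⟩ := Finset.exists_ne_zero_of_sum_ne_zero hv
        rw [← mul_sub] at hc
        have h1 := hcoef _ (left_ne_zero_of_mul hc)
        rw [hammingNorm_insertNth] at h1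
        split_ifs at h1 with hc0
        · subst hc0; simp at hc
        · omega
      have h1 := supp_bound q hq n d (d + 1) _ hS h0 (by omega)
      have h2 : n + 1 - d - (d + 1) = n - 2 * d := by omega
      rwa [h2] at h1)

theorem stmt12 (q n d : ℕ) [NeZero q] (hq : 3 ≤ q) (hd : 1 ≤ d) (hdn : 2 * d ≤ n + 1)
    (f : (Fin n → ZMod q) → ℂ) (hbool : ∀ x, f x = 1 ∨ f x = -1)
    (hcoef : ∀ u : Fin n → ZMod q, fhat q n f u ≠ 0 →
      hammingNorm u = 0 ∨ hammingNorm u = d) :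
    ((univ.filter (fun i : Fin n => Relevant f i)).card : ℝ)
      ≤ (d : ℝ) / 2 * (q : ℝ) ^ (2 * d) / (2 ^ d * ((q : ℝ) - 1) ^ d) := by
  obtain ⟨n, rfl⟩ : ∃ m, n = m + 1 := ⟨n - 1, by omega⟩
  obtain ⟨d, rfl⟩ : ∃ m, d = m + 1 := ⟨d - 1, by omega⟩
  have hlow := lower q n d hq hdn f hbool hcoef
  have hqpos : (0 : ℝ) < q := by positivity
  have hq1 : (0 : ℝ) < (q : ℝ) - 1 := by
    have : (3 : ℝ) ≤ q := by exact_mod_cast hq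
    linarith
  -- upper bound of the total energy
  have hup : ∑ r, ∑ c : ZMod q, ∑ x, ‖f (x + Pi.single r c) - f x‖ ^ 2
      ≤ 2 * (d + 1 : ℝ) * (q : ℝ) ^ (n + 2) := by
    simp_rw [energy]
    rw [← Finset.mul_sum, Finset.sum_comm]
    simp_rw [← Finset.sum_mul]
    have h1 : ∀ u : Fin (n + 1) → ZMod q, ∑ r, (if u r = 0 then (0 : ℝ) else 2 * q)
        = 2 * q * hammingNorm u := by
      intro u
      simp only [hammingNorm, Finset.card_filter]
      push_cast
      rw [Finset.mul_sum]
      refine Finset.sum_congr rfl fun r _ => ?_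
      by_cases h : u r = 0 <;> simp [h]
    simp_rw [h1]
    have h2 : ∑ u, 2 * (q : ℝ) * hammingNorm u * ‖fhat q (n + 1) f u‖ ^ 2
        ≤ ∑ u, 2 * (q : ℝ) * (d + 1) * ‖fhat q (n + 1) f u‖ ^ 2 := by
      refine Finset.sum_le_sum fun u _ => ?_
      by_cases hu : fhat q (n + 1) f u = 0
      · simp [hu]
      · have h3 : (hammingNorm u : ℝ) ≤ d + 1 := by
          have : hammingNorm u ≤ d + 1 := by
            rcases hcoef u hu with h | h <;> omega
          exact_mod_cast this
        gcongr
    have h4 : (q : ℝ) ^ (n + 1) * ∑ u, ‖fhat q (n + 1) f u‖ ^ 2 = (q : ℝ) ^ (n + 1) := by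
      rw [parseval]
      have : ∀ x, ‖f x‖ ^ 2 = 1 := by
        intro x
        rcases hbool x with h | h <;> rw [h] <;> simp
      simp_rw [this]
      simp [ZMod.card]
    calc _ ≤ (q : ℝ) ^ (n + 1) * ∑ u, 2 * (q : ℝ) * (d + 1) * ‖fhat q (n + 1) f u‖ ^ 2 := by gcongr
      _ = 2 * q * (d + 1) * ((q : ℝ) ^ (n + 1) * ∑ u, ‖fhat q (n + 1) f u‖ ^ 2) := by
          rw [← Finset.mul_sum]; ring
      _ = _ := by rw [h4]; ring
  set R := univ.filter (fun i : Fin (n + 1) => Relevant f i) with hR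
  have hmid : (R.card : ℝ) * (4 * ((2 * (q - 1) * (2 ^ d * (q - 1) ^ d * q ^ (n - 2 * d)) : ℕ) : ℝ))
      ≤ ∑ r, ∑ c : ZMod q, ∑ x, ‖f (x + Pi.single r c) - f x‖ ^ 2 := by
    rw [← nsmul_eq_mul]
    refine le_trans (Finset.card_nsmul_le_sum R _ _ fun r hr => hlow r (by simpa [hR] using hr)) ?_
    refine Finset.sum_le_sum_of_subset_of_nonneg (Finset.subset_univ _) fun r _ _ => ?_
    exact Finset.sum_nonneg fun _ _ => Finset.sum_nonneg fun _ _ => by positivity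
  have hfin := hmid.trans hup
  rw [le_div_iff₀ (by positivity)]
  have hcast : ((q - 1 : ℕ) : ℝ) = (q : ℝ) - 1 := by
    rw [Nat.cast_sub (by omega)]; simp
  push_cast at hfin ⊢
  rw [hcast] at hfin
  obtain ⟨e, he⟩ : ∃ e, n = 2 * d + e := ⟨n - 2 * d, by omega⟩
  have he' : n - 2 * d = e := by omega
  have hpow : (q : ℝ) ^ (n + 2) = (q : ℝ) ^ (2 * d + e + 2) := by rw [← he]
  rw [he', hpow] at hfin
  have hqe : (0 : ℝ) < 4 * q ^ e := by positivity
  refine le_of_mul_le_mul_right ?_ hqe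
  calc _ = (R.card : ℝ) * (4 * (2 * ((q : ℝ) - 1) * (2 ^ d * ((q : ℝ) - 1) ^ d * (q : ℝ) ^ e))) := by
        ring
    _ ≤ _ := hfin
    _ = _ := by ring
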